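/- arXiv:1511.01772 — 2 statements merged into one kernel-verified Lean document; each statement's English description precedes it below -/
import Mathlib

section
/- Let C be a monoidal category, let x, y, z be invertible objects of C, and let f : x → y and g : y → z be morphisms in C. If the composite g ∘ f is an isomorphism, then both f and g are isomorphisms. -/
open CategoryTheory MonoidalCategory

/-- An object `x` of a monoidal category is invertible if there is an object `x'`
with `x ⊗ x' ≅ 𝟙_ C` and `x' ⊗ x ≅ 𝟙_ C`. -/
def IsInvertibleObj {C : Type*} [Category C] [MonoidalCategory C] (x : C) : Prop :=
  ∃ x' : C, Nonempty (x ⊗ x' ≅ 𝟙_ C) ∧ Nonempty (x' ⊗ x ≅ 𝟙_ C)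

/-- Tensoring on the right with an object that has a right tensor inverse is faithful. -/
theorem whiskerRight_cancel_of_tensor_iso_unit
    {C : Type*} [Category C] [MonoidalCategory C]
    {w w' : C} (α : w ⊗ w' ≅ 𝟙_ C) {a b : C} {f g : a ⟶ b} (h : f ▷ w = g ▷ w) : f = g := by
  have key : f ▷ (w ⊗ w') = g ▷ (w ⊗ w') := by
    rw [whiskerRight_tensor, whiskerRight_tensor, h]
  have key' : f ▷ 𝟙_ C = g ▷ 𝟙_ C := by
    rw [← cancel_epi (a ◁ α.hom), whisker_exchange, whisker_exchange, key]
  simpa only [whiskerRight_id, Iso.cancel_iso_hom_left, Iso.cancel_iso_inv_right] using key'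

/-- A retract of the unit that has a right tensor inverse is isomorphic to the unit. -/
theorem retraction_comp_section_eq_id_of_unit
    {C : Type*} [Category C] [MonoidalCategory C]
    {w w' : C} (α : w ⊗ w' ≅ 𝟙_ C) {i : w ⟶ 𝟙_ C} {r : 𝟙_ C ⟶ w} (h : i ≫ r = 𝟙 w) :
    r ≫ i = 𝟙 (𝟙_ C) := by
  apply whiskerRight_cancel_of_tensor_iso_unit α
  have : Mono i := ⟨fun a b hab => by
    simpa [h] using congrArg (· ≫ r) hab⟩
  have hi : Mono (𝟙_ C ◁ i) := by
    rw [id_whiskerLeft]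
    infer_instance
  rw [← cancel_mono (𝟙_ C ◁ i), ← whisker_exchange, id_whiskerRight, Category.id_comp,
    whiskerRight_id, id_whiskerLeft, ← unitors_equal, ← unitors_inv_equal]
  simp [reassoc_of% h]

/-- A section between invertible objects is also a retraction. -/
theorem retraction_comp_section_eq_id
    {C : Type*} [Category C] [MonoidalCategory C]
    {x y : C} (hx : IsInvertibleObj x) (hy : IsInvertibleObj y)
    {f : x ⟶ y} {r : y ⟶ x} (h : f ≫ r = 𝟙 x) : r ≫ f = 𝟙 y := by
  obtain ⟨x', ⟨α⟩, -⟩ := hx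
  obtain ⟨y', ⟨β⟩, ⟨γ⟩⟩ := hy
  let δ : (x ⊗ y') ⊗ (y ⊗ x') ≅ 𝟙_ C :=
    α_ x y' (y ⊗ x') ≪≫ whiskerLeftIso x ((α_ y' y x').symm ≪≫ whiskerRightIso γ x' ≪≫ λ_ x') ≪≫ α
  have hw : (f ▷ y' ≫ β.hom) ≫ (β.inv ≫ r ▷ y') = 𝟙 (x ⊗ y') := by
    simp [← comp_whiskerRight, h]
  have key := retraction_comp_section_eq_id_of_unit δ hw
  apply whiskerRight_cancel_of_tensor_iso_unit γ
  rw [← cancel_epi β.inv, ← cancel_mono β.hom]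
  simpa using key

theorem invertible_objects_two_of_composite_iso
    {C : Type*} [Category C] [MonoidalCategory C]
    {x y z : C} (hx : IsInvertibleObj x) (hy : IsInvertibleObj y) (hz : IsInvertibleObj z)
    (f : x ⟶ y) (g : y ⟶ z) (h : IsIso (f ≫ g)) :
    IsIso f ∧ IsIso g := by
  have hr : f ≫ g ≫ inv (f ≫ g) = 𝟙 x := by
    rw [← Category.assoc, IsIso.hom_inv_id]
  have hf : IsIso f := ⟨g ≫ inv (f ≫ g), hr, retraction_comp_section_eq_id hx hy hr⟩
  exact ⟨hf, IsIso.of_isIso_comp_left f g⟩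
end

section
/- Let B be a bicategory, let a and b be objects of B, let f, g, h : a ⟶ b be parallel 1-morphisms each of which is invertible (an equivalence), and let α : f ⟶ g and β : g ⟶ h be 2-morphisms. If the vertical composite β ∘ α : f ⟶ h is an invertible 2-morphism, then both α and β are invertible 2-morphisms. -/
open CategoryTheory Bicategory

/-- A 1-morphism `f : a ⟶ b` in a bicategory is invertible (an equivalence) if there is a
1-morphism `g : b ⟶ a` with invertible 2-morphisms `𝟙 a ≅ f ≫ g` and `g ≫ f ≅ 𝟙 b`. -/
def IsEquivalence1Cell {B : Type*} [Bicategory B] {a b : B} (f : a ⟶ b) : Prop :=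
  ∃ g : b ⟶ a, Nonempty (𝟙 a ≅ f ≫ g) ∧ Nonempty (g ≫ f ≅ 𝟙 b)

/-- Right whiskering by a 1-morphism with a right quasi-inverse is faithful. -/
theorem eq_of_whiskerRight_eq {B : Type*} [Bicategory B] {a b c : B} {p q : a ⟶ b}
    {k : b ⟶ c} {l : c ⟶ b} (i : 𝟙 b ≅ k ≫ l) {η θ : p ⟶ q}
    (w : η ▷ k = θ ▷ k) : η = θ := by
  have h₁ : η ▷ (k ≫ l) = θ ▷ (k ≫ l) := by
    rw [whiskerRight_comp, whiskerRight_comp, w]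
  have h₂ : η ▷ 𝟙 b = θ ▷ 𝟙 b := by
    rw [← cancel_mono (q ◁ i.hom), ← whisker_exchange, ← whisker_exchange, h₁]
  simpa using h₂

/-- An endomorphism of an identity 1-morphism that splits through an equivalence is the
identity. -/
theorem comp_eq_id_of_retract_id {B : Type*} [Bicategory B] {a : B} {u v : a ⟶ a}
    (i : 𝟙 a ≅ u ≫ v) (r : u ⟶ 𝟙 a) (s : 𝟙 a ⟶ u) (w : r ≫ s = 𝟙 u) :
    s ≫ r = 𝟙 (𝟙 a) := by
  apply eq_of_whiskerRight_eq i
  have hm : Mono r := mono_of_mono_fac w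
  have e : (s ≫ r) ▷ u ≫ 𝟙 a ◁ r = 𝟙 a ◁ r := by
    rw [← whisker_exchange]
    simp [reassoc_of% w]
  have hm' : Mono (𝟙 a ◁ r) := by
    rw [id_whiskerLeft]
    infer_instance
  rw [← cancel_mono (𝟙 a ◁ r), e]
  simp

/-- A retraction between equivalences is a two-sided inverse. -/
theorem IsEquivalence1Cell.comp_eq_id {B : Type*} [Bicategory B] {a b : B} {f g : a ⟶ b}
    (hf : IsEquivalence1Cell f) (hg : IsEquivalence1Cell g)
    (α : f ⟶ g) (γ : g ⟶ f) (w : α ≫ γ = 𝟙 f) : γ ≫ α = 𝟙 g := by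
  obtain ⟨l, ⟨i⟩, -⟩ := hf
  obtain ⟨k, ⟨j⟩, ⟨m⟩⟩ := hg
  have n : 𝟙 a ≅ (f ≫ k) ≫ g ≫ l :=
    i ≪≫ whiskerLeftIso f ((λ_ l).symm ≪≫ whiskerRightIso m.symm l ≪≫ α_ k g l) ≪≫
      (α_ f k (g ≫ l)).symm
  have e := comp_eq_id_of_retract_id n (α ▷ k ≫ j.inv) (j.hom ≫ γ ▷ k)
    (by simp [← comp_whiskerRight, w])
  apply eq_of_whiskerRight_eq m.symm
  rw [← cancel_epi j.hom, ← cancel_mono j.inv]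
  simpa using e

theorem two_morphisms_invertible_of_composite_invertible
    {B : Type*} [Bicategory B] {a b : B} {f g h : a ⟶ b}
    (hf : IsEquivalence1Cell f) (hg : IsEquivalence1Cell g) (hh : IsEquivalence1Cell h)
    (α : f ⟶ g) (β : g ⟶ h) (hc : IsIso (α ≫ β)) :
    IsIso α ∧ IsIso β := by
  have e := hf.comp_eq_id hg α (β ≫ inv (α ≫ β)) (by rw [← Category.assoc, IsIso.hom_inv_id])
  have hα : IsIso α :=
    ⟨β ≫ inv (α ≫ β), by rw [← Category.assoc, IsIso.hom_inv_id], e⟩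
  exact ⟨hα, IsIso.of_isIso_comp_left α β⟩
end
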